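/- Let X be a separable Banach space. Then there exist a separable Hilbert space Y and a bounded linear operator S ∈ L(Y;X) such that S is injective, the image of S is dense in X, and S is a compact operator. -/

import Mathlib

/-- The construction, for an abstract Hilbert space with a countable Hilbert basis. -/
theorem exists_compact_dense_aux.{u}
    {X : Type u} [NormedAddCommGroup X] [NormedSpace ℝ X] [CompleteSpace X]
    [TopologicalSpace.SeparableSpace X]
    {H : Type u} [NormedAddCommGroup H] [InnerProductSpace ℝ H] [CompleteSpace H]
    (b : HilbertBasis (ULift.{u} ℕ) ℝ H) :
    ∃ (Y : Type u) (_ : NormedAddCommGroup Y) (_ : InnerProductSpace ℝ Y)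
      (_ : CompleteSpace Y) (_ : TopologicalSpace.SeparableSpace Y)
      (S : Y →L[ℝ] X),
      Function.Injective ⇑S ∧ DenseRange ⇑S ∧ IsCompactOperator ⇑S := by
  have hsep : TopologicalSpace.SeparableSpace H := by
    rw [← TopologicalSpace.isSeparable_univ_iff]
    have h1 : TopologicalSpace.IsSeparable (Set.range (b : ULift.{u} ℕ → H)) :=
      (Set.countable_range _).isSeparable
    have h2 := (h1.span (R := ℝ)).closure
    have h3 := congrArg (fun K : Submodule ℝ H => (K : Set H)) b.dense_span
    simp only [Submodule.topologicalClosure_coe, Submodule.top_coe] at h3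
    rwa [h3] at h2
  let x : ℕ → X := TopologicalSpace.denseSeq X
  let c : ℕ → ℝ := fun n => (1 / 2 : ℝ) ^ n / (1 + ‖x n‖)
  have hc : ∀ n, 0 < c n := fun n => by positivity
  have hcx : ∀ n, ‖c n • x n‖ ≤ (1 / 2 : ℝ) ^ n := by
    intro n
    rw [norm_smul, Real.norm_of_nonneg (hc n).le]
    change (1 / 2 : ℝ) ^ n / (1 + ‖x n‖) * ‖x n‖ ≤ _
    rw [div_mul_eq_mul_div, div_le_iff₀ (by positivity)]
    have : (0 : ℝ) < (1 / 2) ^ n := by positivity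
    nlinarith
  let A : ℕ → (H →L[ℝ] X) := fun n => (innerSL ℝ (b ⟨n⟩)).smulRight (c n • x n)
  have hA : Summable A := by
    refine Summable.of_norm_bounded (g := fun n => (1 / 2 : ℝ) ^ n) summable_geometric_two ?_
    intro n
    change ‖(innerSL ℝ (b ⟨n⟩)).smulRight (c n • x n)‖ ≤ _
    rw [ContinuousLinearMap.norm_smulRight_apply, innerSL_apply_norm, b.orthonormal.1, one_mul]
    exact hcx n
  obtain ⟨T, hT⟩ := hA
  have hAc : ∀ n, IsCompactOperator (A n) := by
    intro n
    have h1 : IsCompactOperator (innerSL ℝ (b ⟨n⟩)) := by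
      refine ⟨Set.univ ∩ Metric.closedBall 0 1, by simpa using isCompact_closedBall (0 : ℝ) 1, ?_⟩
      refine (innerSL ℝ (b ⟨n⟩)).continuous.continuousAt.preimage_mem_nhds ?_
      simpa using Metric.closedBall_mem_nhds (0 : ℝ) one_pos
    exact h1.clm_comp (ContinuousLinearMap.toSpanSingleton ℝ (c n • x n))
  have hTc : IsCompactOperator T := by
    refine isCompactOperator_of_tendsto hT (Filter.Eventually.of_forall fun s => ?_)
    exact (compactOperator (RingHom.id ℝ) H X).sum_mem (t := s) (f := A) (fun n _ => hAc n)
  have hTb : ∀ m, T (b ⟨m⟩) = c m • x m := by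
    intro m
    have h1 : HasSum (fun n => A n (b ⟨m⟩)) (T (b ⟨m⟩)) :=
      hT.mapL (ContinuousLinearMap.apply ℝ X (b ⟨m⟩))
    refine h1.unique ?_
    have h2 : A m (b ⟨m⟩) = c m • x m := by
      simp [A, b.orthonormal.1]
    rw [← h2]
    refine hasSum_single m fun n hn => ?_
    have : inner ℝ (b ⟨n⟩) (b ⟨m⟩) = (0 : ℝ) := b.orthonormal.2 (by simpa using hn)
    simp [A, this]
  have hTd : DenseRange T := by
    refine (TopologicalSpace.denseRange_denseSeq X).mono ?_
    rintro _ ⟨m, rfl⟩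
    refine ⟨(c m)⁻¹ • b ⟨m⟩, ?_⟩
    rw [map_smul, hTb, smul_smul, inv_mul_cancel₀ (hc m).ne', one_smul]
  let K : Submodule ℝ H := LinearMap.ker (T : H →ₗ[ℝ] X)
  have hK : IsClosed (K : Set H) := T.isClosed_ker
  haveI : CompleteSpace K := hK.completeSpace_coe
  refine ⟨Kᗮ, inferInstance, inferInstance, inferInstance, inferInstance,
    T.comp Kᗮ.subtypeL, ?_, ?_, hTc.comp_clm _⟩
  · rw [injective_iff_map_eq_zero]
    intro v hv
    have h1 : (v : H) ∈ K := hv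
    have h2 : (v : H) ∈ K ⊓ Kᗮ := ⟨h1, v.2⟩
    rw [Submodule.inf_orthogonal_eq_bot] at h2
    exact Subtype.ext h2
  · refine hTd.mono ?_
    rintro _ ⟨v, rfl⟩
    obtain ⟨y, hy, z, hz, rfl⟩ := K.exists_add_mem_mem_orthogonal v
    refine ⟨⟨z, hz⟩, ?_⟩
    have hy' : T y = 0 := hy
    simp [hy']

/-- For every separable Banach space `X` there exist a separable
Hilbert space `Y` and a bounded linear operator `S : Y → X` which is injective,
has dense range, and is compact. -/
theorem exists_hilbert_compact_dense_into.{u}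
    {X : Type u} [NormedAddCommGroup X] [NormedSpace ℝ X] [CompleteSpace X]
    [TopologicalSpace.SeparableSpace X] :
    ∃ (Y : Type u) (_ : NormedAddCommGroup Y) (_ : InnerProductSpace ℝ Y)
      (_ : CompleteSpace Y) (_ : TopologicalSpace.SeparableSpace Y)
      (S : Y →L[ℝ] X),
      Function.Injective ⇑S ∧ DenseRange ⇑S ∧ IsCompactOperator ⇑S := by
  exact exists_compact_dense_aux (H := lp (fun _ : ULift.{u} ℕ => ℝ) 2)
    ⟨LinearIsometryEquiv.refl ℝ _⟩
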